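/- arXiv:1711.10512 — 3 statements merged into one kernel-verified Lean document; each statement's English description precedes it below -/
import Mathlib

section
/- The distillation fidelity SDP is expressed through the monotone Θ^J: for every d×d density matrix ρ and every integer m ≥ 1, max { Re Tr(Gρ) : G Hermitian, 0 ≤ G ≤ 𝟙, Δ(G) = (1/m)𝟙 } = (1/m)·( Θ^J_{m−1}(ρ) + 1 ), where for m = 1 the quantity Θ^J_0(ρ) := sup { Re Tr(ρW) : W Hermitian, −𝟙 ≤ W ≤ 0, Δ(W) = 0 }. -/
open Matrix Kronecker BigOperators ComplexOrder

/-- The completely dephasing map Δ, sending a matrix to its diagonal part. -/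
noncomputable def deph {n : ℕ} (A : Matrix (Fin n) (Fin n) ℂ) : Matrix (Fin n) (Fin n) ℂ :=
  Matrix.diagonal (fun i => A i i)

/-- A density matrix: positive semidefinite with unit trace. -/
def IsDensity {n : ℕ} (ρ : Matrix (Fin n) (Fin n) ℂ) : Prop :=
  ρ.PosSemidef ∧ ρ.trace = 1

/-- Θ_m(ρ) = sup { Re Tr(ρW) : W Hermitian, −𝟙 ≤ W ≤ m𝟙, Δ(W) ≤ 0 }. -/
noncomputable def Theta {d : ℕ} (m : ℝ) (ρ : Matrix (Fin d) (Fin d) ℂ) : ℝ :=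
  sSup {x : ℝ | ∃ W : Matrix (Fin d) (Fin d) ℂ, W.IsHermitian ∧
    (W + 1).PosSemidef ∧ ((m : ℂ) • (1 : Matrix (Fin d) (Fin d) ℂ) - W).PosSemidef ∧
    (-(deph W)).PosSemidef ∧ x = ((ρ * W).trace).re}

/-- Θ^J_m(ρ) = sup { Re Tr(ρW) : W Hermitian, −𝟙 ≤ W ≤ m𝟙, Δ(W) = 0 }. -/
noncomputable def ThetaJ {d : ℕ} (m : ℝ) (ρ : Matrix (Fin d) (Fin d) ℂ) : ℝ :=
  sSup {x : ℝ | ∃ W : Matrix (Fin d) (Fin d) ℂ, W.IsHermitian ∧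
    (W + 1).PosSemidef ∧ ((m : ℂ) • (1 : Matrix (Fin d) (Fin d) ℂ) - W).PosSemidef ∧
    deph W = 0 ∧ x = ((ρ * W).trace).re}

/-- The trace of a product of two positive semidefinite matrices is nonnegative. -/
theorem Matrix.PosSemidef.trace_mul_nonneg {n : Type*} [Fintype n]
    {A B : Matrix n n ℂ} (hA : A.PosSemidef) (hB : B.PosSemidef) : 0 ≤ (A * B).trace := by
  obtain ⟨k, v, rfl⟩ := Matrix.posSemidef_iff_eq_sum_vecMulVec.mp hA
  rw [Matrix.sum_mul, Matrix.trace_sum]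
  refine Finset.sum_nonneg fun i _ => ?_
  rw [Matrix.trace_mul_comm, Matrix.mul_vecMulVec, Matrix.trace_vecMulVec, dotProduct_comm]
  exact hB.dotProduct_mulVec_nonneg (v i)

/-- `Re Tr(ρW)` is bounded by `m` when `ρ` is a density matrix and `W ≤ m𝟙`. -/
theorem IsDensity.re_trace_mul_le {d : ℕ} {m : ℝ} {ρ W : Matrix (Fin d) (Fin d) ℂ}
    (hρ : IsDensity ρ) (hW : ((m : ℂ) • (1 : Matrix (Fin d) (Fin d) ℂ) - W).PosSemidef) :
    ((ρ * W).trace).re ≤ m := by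
  have h := (Complex.le_def.mp (hρ.1.trace_mul_nonneg hW)).1
  simpa [Matrix.mul_sub, hρ.2] using h

/-- The set of values over which `ThetaJ` takes the supremum is bounded above. -/
theorem bddAbove_thetaJ_values {d : ℕ} (m : ℝ) {ρ : Matrix (Fin d) (Fin d) ℂ}
    (hρ : IsDensity ρ) :
    BddAbove {x : ℝ | ∃ W : Matrix (Fin d) (Fin d) ℂ, W.IsHermitian ∧
      (W + 1).PosSemidef ∧ ((m : ℂ) • (1 : Matrix (Fin d) (Fin d) ℂ) - W).PosSemidef ∧
      deph W = 0 ∧ x = ((ρ * W).trace).re} := by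
  refine ⟨m, ?_⟩
  rintro x ⟨W, -, -, hW, -, rfl⟩
  exact hρ.re_trace_mul_le hW

/-- For `m ≥ 0` the set of values over which `ThetaJ` takes the supremum contains `0`. -/
theorem zero_mem_thetaJ_values {d : ℕ} {m : ℝ} (hm : 0 ≤ m) (ρ : Matrix (Fin d) (Fin d) ℂ) :
    (0 : ℝ) ∈ {x : ℝ | ∃ W : Matrix (Fin d) (Fin d) ℂ, W.IsHermitian ∧
      (W + 1).PosSemidef ∧ ((m : ℂ) • (1 : Matrix (Fin d) (Fin d) ℂ) - W).PosSemidef ∧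
      deph W = 0 ∧ x = ((ρ * W).trace).re} := by
  refine ⟨0, Matrix.isHermitian_zero, ?_, ?_, ?_, by simp⟩
  · simpa using (Matrix.PosSemidef.one : (1 : Matrix (Fin d) (Fin d) ℂ).PosSemidef)
  · simpa using (Matrix.PosSemidef.one : (1 : Matrix (Fin d) (Fin d) ℂ).PosSemidef).smul
      (Complex.zero_le_real.mpr hm)
  · ext i j
    simp [deph]

/-- the distillation-fidelity SDP equals (1/m)(Θ^J_{m−1}(ρ) + 1):
sup { Re Tr(Gρ) : 0 ≤ G ≤ 𝟙, Δ(G) = (1/m)𝟙 } = (1/m)(Θ^J_{m−1}(ρ) + 1). -/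
theorem fidelity_SDP_eq_thetaJ {d : ℕ} (m : ℕ) (hm : 1 ≤ m)
    (ρ : Matrix (Fin d) (Fin d) ℂ) (hρ : IsDensity ρ) :
    sSup {x : ℝ | ∃ G : Matrix (Fin d) (Fin d) ℂ, G.IsHermitian ∧
        G.PosSemidef ∧ (1 - G).PosSemidef ∧
        deph G = ((m : ℂ))⁻¹ • (1 : Matrix (Fin d) (Fin d) ℂ) ∧
        x = ((ρ * G).trace).re} =
      (1 / (m : ℝ)) * (ThetaJ ((m : ℝ) - 1) ρ + 1) := by
  have hm₀ : (0 : ℝ) < m := by exact_mod_cast hm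
  have hmc : (m : ℂ) ≠ 0 := by exact_mod_cast hm₀.ne'
  have hmnn : (0 : ℂ) ≤ m := by exact_mod_cast hm₀.le
  have hinv : (0 : ℂ) ≤ (m : ℂ)⁻¹ := by
    rw [← Complex.ofReal_natCast, ← Complex.ofReal_inv]
    exact Complex.zero_le_real.mpr (inv_nonneg.mpr hm₀.le)
  have hmono : Monotone fun x : ℝ => 1 / (m : ℝ) * (x + 1) := fun x y hxy => by
    dsimp only
    gcongr
  have hcont : Continuous fun x : ℝ => 1 / (m : ℝ) * (x + 1) := by fun_prop
  have hm₁ : (0 : ℝ) ≤ (m : ℝ) - 1 := sub_nonneg.mpr (by exact_mod_cast hm)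
  rw [ThetaJ, hmono.map_csSup_of_continuousAt hcont.continuousAt
    ⟨0, zero_mem_thetaJ_values hm₁ ρ⟩ (bddAbove_thetaJ_values _ hρ)]
  congr 1
  ext x
  constructor
  · rintro ⟨G, -, hG₀, hG₁, hdiag, rfl⟩
    have hW : ((m : ℂ) • G - 1).IsHermitian :=
      (hG₀.smul hmnn).isHermitian.sub Matrix.isHermitian_one
    refine ⟨_, ⟨(m : ℂ) • G - 1, hW, ?_, ?_, ?_, rfl⟩, ?_⟩
    · simpa using hG₀.smul hmnn
    · convert hG₁.smul hmnn using 1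
      push_cast
      module
    · ext i j
      have hij := congrFun (congrFun hdiag i) j
      by_cases h : i = j
      · subst h
        simp only [deph, Matrix.diagonal_apply_eq, Matrix.smul_apply, Matrix.one_apply_eq,
          smul_eq_mul, mul_one] at hij
        simp [deph, hij, hmc]
      · simp [deph, h]
    · simp [Matrix.mul_sub, hρ.2, hm₀.ne']
  · rintro ⟨_, ⟨W, -, hW₀, hW₁, hdiag, rfl⟩, rfl⟩
    have hG₀ : ((m : ℂ)⁻¹ • (W + 1)).PosSemidef := hW₀.smul hinv
    refine ⟨(m : ℂ)⁻¹ • (W + 1), hG₀.isHermitian, hG₀, ?_, ?_, ?_⟩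
    · convert hW₁.smul hinv using 1
      push_cast
      rw [smul_sub, smul_smul, mul_sub, inv_mul_cancel₀ hmc]
      module
    · ext i j
      have hij := congrFun (congrFun hdiag i) j
      by_cases h : i = j
      · subst h
        simp only [deph, Matrix.diagonal_apply_eq, Matrix.zero_apply] at hij
        simp [deph, hij]
      · simp [deph, h]
    · have hcast : (m : ℂ)⁻¹ = ((m : ℝ)⁻¹ : ℝ) := by push_cast; rfl
      simp [hρ.2, hcast, -Complex.ofReal_inv, mul_add]
end

section
/- For pure states the SIO distillation fidelity equals the normalized squared m-distillation norm: for every unit vector ψ ∈ ℂ^d and every positive integer m, F_SIO(ψψ*, m) = (1/m)·‖ψ‖_[m]², where ψψ* is the rank-one density matrix associated with ψ. -/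
open Matrix Kronecker BigOperators ComplexOrder

/-- The m-distillation norm ‖ψ‖_[m] = inf { ‖x‖₁ + √m ‖y‖₂ : x + y = ψ }. -/
noncomputable def mnorm {d : ℕ} (m : ℝ) (ψ : Fin d → ℂ) : ℝ :=
  sInf {r : ℝ | ∃ x y : Fin d → ℂ, x + y = ψ ∧
    r = (∑ i, ‖x i‖) + Real.sqrt m * Real.sqrt (∑ i, ‖y i‖ ^ 2)}

/-- An incoherent operator: K σ K* is diagonal for every diagonal PSD matrix σ. -/
def IsIncoherentOp {a b : ℕ} (K : Matrix (Fin b) (Fin a) ℂ) : Prop :=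
  ∀ σ : Matrix (Fin a) (Fin a) ℂ, σ.PosSemidef → σ = deph σ →
    K * σ * Kᴴ = deph (K * σ * Kᴴ)

/-- The m-dimensional maximally coherent state Ψ_m = (1/m) ∑_{i,j} e_i e_j*. -/
noncomputable def maxCoh (m : ℕ) : Matrix (Fin m) (Fin m) ℂ :=
  Matrix.of fun _ _ => (1 : ℂ) / m

/-- The fidelity of coherence distillation under SIO: the supremum of Re Tr(E(ρ) Ψ_m) over
channels E(ρ) = ∑_ℓ K_ℓ ρ K_ℓ* with ∑_ℓ K_ℓ* K_ℓ = 𝟙 where every Kraus operator K_ℓ and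
every adjoint K_ℓᴴ is an incoherent operator. -/
noncomputable def FSIO {d : ℕ} (ρ : Matrix (Fin d) (Fin d) ℂ) (m : ℕ) : ℝ :=
  sSup {x : ℝ | ∃ (n : ℕ) (K : Fin n → Matrix (Fin m) (Fin d) ℂ),
    (∀ ℓ, IsIncoherentOp (K ℓ) ∧ IsIncoherentOp (K ℓ)ᴴ) ∧
    (∑ ℓ, (K ℓ)ᴴ * K ℓ = 1) ∧
    x = (((∑ ℓ, K ℓ * ρ * (K ℓ)ᴴ) * maxCoh m).trace).re}

/-- The rank-one density matrix ψψ* associated with a vector ψ. -/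
noncomputable def outer {d : ℕ} (ψ : Fin d → ℂ) : Matrix (Fin d) (Fin d) ℂ :=
  Matrix.of fun i j => ψ i * star (ψ j)

/-- The overlap of `∑ K ψψ* K*` with the maximally coherent state. -/
lemma re_trace_kraus_outer_mul_maxCoh {d m : ℕ} {ι : Type*} [Fintype ι]
    (K : ι → Matrix (Fin m) (Fin d) ℂ) (ψ : Fin d → ℂ) :
    (((∑ l, K l * outer ψ * (K l)ᴴ) * maxCoh m).trace).re =
      (1 / (m : ℝ)) * ∑ l, ‖∑ i, (K l *ᵥ ψ) i‖ ^ 2 := by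
  have key : ∀ l, K l * outer ψ * (K l)ᴴ = outer (K l *ᵥ ψ) := by
    intro l
    change K l * vecMulVec ψ (star ψ) * (K l)ᴴ = vecMulVec (K l *ᵥ ψ) (star (K l *ᵥ ψ))
    rw [mul_vecMulVec, vecMulVec_mul, star_mulVec]
  have tr : ∀ φ : Fin m → ℂ, (outer φ * maxCoh m).trace =
      (((1 / (m : ℝ)) * ‖∑ i, φ i‖ ^ 2 : ℝ) : ℂ) := by
    intro φ
    push_cast
    rw [← Complex.mul_conj', map_sum, Finset.sum_mul_sum, Finset.mul_sum]
    simp only [Matrix.trace, Matrix.diag, Matrix.mul_apply, outer, maxCoh, Matrix.of_apply]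
    refine Finset.sum_congr rfl fun i _ => ?_
    rw [Finset.mul_sum]
    refine Finset.sum_congr rfl fun j _ => ?_
    rw [mul_comm]; rfl
  simp only [key, Finset.sum_mul, Matrix.trace_sum, tr]
  rw [← Complex.ofReal_sum, Complex.ofReal_re, Finset.mul_sum]

/-- Every column of an incoherent operator has at most one nonzero entry. -/
lemma IsIncoherentOp.mul_star_eq_zero {a b : ℕ} {K : Matrix (Fin b) (Fin a) ℂ}
    (hK : IsIncoherentOp K) {i k : Fin b} (hik : i ≠ k) (j : Fin a) :
    K i j * star (K k j) = 0 := by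
  have h := congrFun₂ (hK (Matrix.diagonal (Pi.single j 1))
    (Matrix.PosSemidef.diagonal (by
      intro l; by_cases hl : l = j
      · subst hl; simp
      · simp [hl])) (by simp [deph])) i k
  simpa [deph, hik, Matrix.mul_apply, Matrix.diagonal_apply, Pi.single_apply] using h

lemma isIncoherentOp_of_mul_star_eq_zero {a b : ℕ} {K : Matrix (Fin b) (Fin a) ℂ}
    (hK : ∀ i k j, i ≠ k → K i j * star (K k j) = 0) : IsIncoherentOp K := by
  intro σ _ hσ
  ext i k
  by_cases hik : i = k
  · subst hik; simp [deph]
  rw [deph, Matrix.diagonal_apply_ne _ hik, hσ]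
  rw [Matrix.mul_apply]
  refine Finset.sum_eq_zero fun j _ => ?_
  rw [deph, Matrix.mul_diagonal, Matrix.conjTranspose_apply]
  rw [mul_right_comm, hK i k j hik, zero_mul]

/-- The columnwise normalization of a Kraus family. -/
lemma sum_norm_sq_col {d m n : ℕ} {K : Fin n → Matrix (Fin m) (Fin d) ℂ}
    (h1 : ∑ l, (K l)ᴴ * K l = 1) (j : Fin d) : ∑ l, ∑ i, ‖K l i j‖ ^ 2 = 1 := by
  have h := congrFun₂ h1 j j
  simp only [Matrix.sum_apply, Matrix.mul_apply, Matrix.conjTranspose_apply, Matrix.one_apply_eq,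
    Complex.star_def, Complex.conj_mul'] at h
  exact_mod_cast h

lemma sum_norm_sq_mulVec {d m n : ℕ} {K : Fin n → Matrix (Fin m) (Fin d) ℂ}
    (h1 : ∑ l, (K l)ᴴ * K l = 1) (y : Fin d → ℂ) :
    ∑ l, ∑ i, ‖(K l *ᵥ y) i‖ ^ 2 = ∑ j, ‖y j‖ ^ 2 := by
  have sq : ∀ (k : ℕ) (v : Fin k → ℂ), star v ⬝ᵥ v = ((∑ i, ‖v i‖ ^ 2 : ℝ) : ℂ) := by
    intro k v
    simp [dotProduct, Complex.conj_mul']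
  have h : ∑ l, star (K l *ᵥ y) ⬝ᵥ (K l *ᵥ y) = star y ⬝ᵥ y := by
    calc _ = ∑ l, star y ⬝ᵥ (((K l)ᴴ * K l) *ᵥ y) := by
          refine Finset.sum_congr rfl fun l _ => ?_
          rw [star_mulVec, ← dotProduct_mulVec, mulVec_mulVec]
      _ = star y ⬝ᵥ ((∑ l, (K l)ᴴ * K l) *ᵥ y) := by
          rw [sum_mulVec, dotProduct_sum]
      _ = _ := by rw [h1, one_mulVec]
  simp only [sq] at h
  exact_mod_cast h

/-- The overlap amplitude of an incoherent Kraus family is bounded by the `m`-distillation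
norm, expressed through an arbitrary splitting `x + y`. -/
lemma sqrt_sum_norm_sq_le {d m n : ℕ} {K : Fin n → Matrix (Fin m) (Fin d) ℂ}
    (hK : ∀ l, IsIncoherentOp (K l)) (h1 : ∑ l, (K l)ᴴ * K l = 1) (x y : Fin d → ℂ) :
    Real.sqrt (∑ l, ‖∑ i, (K l *ᵥ (x + y)) i‖ ^ 2) ≤
      (∑ i, ‖x i‖) + Real.sqrt m * Real.sqrt (∑ i, ‖y i‖ ^ 2) := by
  let T : (Fin d → ℂ) → EuclideanSpace ℂ (Fin n) :=
    fun v => WithLp.toLp 2 fun l => ∑ i, (K l *ᵥ v) i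
  have hT : ∀ v, ‖T v‖ = Real.sqrt (∑ l, ‖∑ i, (K l *ᵥ v) i‖ ^ 2) :=
    fun v => EuclideanSpace.norm_eq _
  have hadd : T (x + y) = T x + T y := by
    ext l
    simp [T, mulVec_add, Finset.sum_add_distrib]
  have hcol : ∀ j, ‖(WithLp.toLp 2 fun l => ∑ i, K l i j : EuclideanSpace ℂ (Fin n))‖ = 1 := by
    intro j
    rw [EuclideanSpace.norm_eq, Real.sqrt_eq_one, ← sum_norm_sq_col h1 j]
    refine Finset.sum_congr rfl fun l _ => ?_
    have hc : (((‖∑ i, K l i j‖ ^ 2 : ℝ)) : ℂ) = ((∑ i, ‖K l i j‖ ^ 2 : ℝ) : ℂ) := by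
      push_cast
      rw [← Complex.mul_conj', map_sum, Finset.sum_mul_sum]
      refine Finset.sum_congr rfl fun i _ => ?_
      rw [Finset.sum_eq_single i, Complex.mul_conj']
      · intro k _ hk
        exact (hK l).mul_star_eq_zero hk.symm j
      · simp
    exact_mod_cast hc
  have hx : ‖T x‖ ≤ ∑ i, ‖x i‖ := by
    have : T x = ∑ j, x j • (WithLp.toLp 2 fun l => ∑ i, K l i j : EuclideanSpace ℂ (Fin n)) := by
      ext l
      simp only [T, mulVec, dotProduct, WithLp.ofLp_sum, WithLp.ofLp_smul, Finset.sum_apply,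
        Pi.smul_apply, smul_eq_mul, Finset.mul_sum]
      rw [Finset.sum_comm]
      exact Finset.sum_congr rfl fun _ _ => Finset.sum_congr rfl fun _ _ => mul_comm _ _
    rw [this]
    refine (norm_sum_le _ _).trans (le_of_eq ?_)
    exact Finset.sum_congr rfl fun j _ => by rw [norm_smul, hcol, mul_one]
  have hy : ‖T y‖ ≤ Real.sqrt m * Real.sqrt (∑ i, ‖y i‖ ^ 2) := by
    rw [hT, ← Real.sqrt_mul (Nat.cast_nonneg m)]
    refine Real.sqrt_le_sqrt ?_
    rw [← sum_norm_sq_mulVec h1 y, Finset.mul_sum]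
    refine Finset.sum_le_sum fun l _ => ?_
    calc _ ≤ (∑ i, ‖(K l *ᵥ y) i‖) ^ 2 := by
          gcongr
          exact norm_sum_le _ _
      _ ≤ _ := by simpa using sq_sum_le_card_mul_sum_sq (s := Finset.univ)
                    (f := fun i => ‖(K l *ᵥ y) i‖)
  rw [← hT, hadd]
  exact (norm_add_le _ _).trans (add_le_add hx hy)

/-- Strong duality for the `m`-distillation norm of a nonnegative vector: soft thresholding
produces a splitting together with a dual certificate `z`. -/
lemma exists_split_and_dual {d : ℕ} (a : Fin d → ℝ) (ha : ∀ j, 0 ≤ a j)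
    (ha1 : ∑ j, a j ^ 2 = 1) (m : ℕ) (hm : 1 ≤ m) :
    ∃ z x y : Fin d → ℝ, (∀ j, 0 ≤ z j) ∧ (∀ j, z j ≤ 1) ∧ ∑ j, z j ^ 2 ≤ m ∧
      (∀ j, 0 ≤ x j) ∧ (∀ j, 0 ≤ y j) ∧ (∀ j, x j + y j = a j) ∧
      ∑ j, x j + Real.sqrt m * Real.sqrt (∑ j, y j ^ 2) = ∑ j, z j * a j := by
  classical
  set s : Finset (Fin d) := Finset.univ.filter fun j => a j ≠ 0 with hs
  by_cases hc : s.card ≤ m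
  · refine ⟨fun j => if a j ≠ 0 then 1 else 0, a, 0, ?_, ?_, ?_, ha, by simp, by simp, ?_⟩
    · intro j; dsimp only; split_ifs <;> norm_num
    · intro j; dsimp only; split_ifs <;> norm_num
    · have : ∑ j, (if a j ≠ 0 then (1 : ℝ) else 0) ^ 2 = s.card := by
        simp [hs, ite_pow, Finset.sum_ite]
      rw [this]; exact_mod_cast hc
    · simp only [Pi.zero_apply]
      norm_num
      refine Finset.sum_congr rfl fun j _ => ?_
      split_ifs with h <;> simp [h]
  push Not at hc
  have hne : s.Nonempty := Finset.card_pos.1 (by omega)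
  obtain ⟨j₀, hj₀, hmin⟩ := s.exists_min_image a hne
  have h0 : 0 < a j₀ := lt_of_le_of_ne (ha j₀) (Ne.symm (Finset.mem_filter.1 hj₀).2)
  have h01 : a j₀ ≤ 1 := by
    have := Finset.single_le_sum (f := fun j => a j ^ 2) (fun j _ => sq_nonneg _)
      (Finset.mem_univ j₀)
    nlinarith
  have hm1 : (1 : ℝ) ≤ m := by exact_mod_cast hm
  have hcont : Continuous fun t : ℝ => ∑ j, min (a j) t ^ 2 - m * t ^ 2 := by fun_prop
  have hlow : 0 ≤ ∑ j, min (a j) (a j₀) ^ 2 - m * a j₀ ^ 2 := by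
    have h2 : ∑ j ∈ s, a j₀ ^ 2 ≤ ∑ j, min (a j) (a j₀) ^ 2 := by
      refine le_trans (Finset.sum_le_sum fun j hj => ?_)
        (Finset.sum_le_sum_of_subset_of_nonneg s.subset_univ fun j _ _ => sq_nonneg _)
      rw [min_eq_right (hmin j hj)]
    rw [Finset.sum_const, nsmul_eq_mul] at h2
    have : (m : ℝ) ≤ s.card := by exact_mod_cast hc.le
    nlinarith [sq_nonneg (a j₀)]
  have hhigh : ∑ j, min (a j) 1 ^ 2 - m * (1 : ℝ) ^ 2 ≤ 0 := by
    have : ∑ j, min (a j) 1 ^ 2 ≤ ∑ j, a j ^ 2 := by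
      refine Finset.sum_le_sum fun j _ => ?_
      exact pow_le_pow_left₀ (le_min (ha j) zero_le_one) (min_le_left _ _) 2
    linarith
  obtain ⟨t, ⟨ht, -⟩, hgt⟩ := intermediate_value_Icc' h01 hcont.continuousOn ⟨hhigh, hlow⟩
  have ht0 : 0 < t := h0.trans_le ht
  have hsum : ∑ j, min (a j) t ^ 2 = m * t ^ 2 := by linarith [hgt]
  refine ⟨fun j => min (a j) t / t, fun j => a j - min (a j) t, fun j => min (a j) t,
    fun j => div_nonneg (le_min (ha j) ht0.le) ht0.le,
    fun j => (div_le_one ht0).2 (min_le_right _ _), ?_,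
    fun j => sub_nonneg.2 (min_le_left _ _), fun j => le_min (ha j) ht0.le, fun j => by ring, ?_⟩
  · simp only [div_pow, ← Finset.sum_div, hsum]
    rw [mul_div_cancel_right₀ _ (by positivity)]
  · have hsq : Real.sqrt m * Real.sqrt (m * t ^ 2) = m * t ^ 2 / t := by
      rw [Real.sqrt_mul (Nat.cast_nonneg m), Real.sqrt_sq ht0.le, ← mul_assoc,
        Real.mul_self_sqrt (Nat.cast_nonneg m)]
      field_simp
    rw [hsum, hsq, ← hsum, Finset.sum_div, ← Finset.sum_add_distrib]
    refine Finset.sum_congr rfl fun j _ => ?_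
    rcases le_total (a j) t with h | h
    · simp only [min_eq_left h]
      ring
    · simp only [min_eq_right h]
      field_simp
      ring

/-- A vector `p` with entries in `[0, 1]` and sum at most `m` gives rise to a random partial
matching of `Fin m` with `Fin d` in which each pair `(i, j)` occurs with probability `p j / m`. -/
lemma exists_perm_weights {d m : ℕ} (hm : 1 ≤ m) (p : Fin d → ℝ) (hp0 : ∀ j, 0 ≤ p j)
    (hp1 : ∀ j, p j ≤ 1) (hpm : ∑ j, p j ≤ m) :
    ∃ w : Equiv.Perm (Fin m ⊕ Fin d) → ℝ, (∀ σ, 0 ≤ w σ) ∧ ∑ σ, w σ = 1 ∧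
      ∀ i j, ∑ σ, w σ * (if σ (Sum.inl i) = Sum.inr j then 1 else 0) = p j / m := by
  have hm0 : (0 : ℝ) < m := by exact_mod_cast hm
  let M : Matrix (Fin m ⊕ Fin d) (Fin m ⊕ Fin d) ℝ :=
    Matrix.fromBlocks (Matrix.diagonal fun _ => 1 - (∑ j, p j) / m) (Matrix.of fun _ j => p j / m)
      (Matrix.of fun j _ => p j / m) (Matrix.diagonal fun j => 1 - p j)
  have hM : M ∈ doublyStochastic ℝ (Fin m ⊕ Fin d) := by
    rw [mem_doublyStochastic_iff_sum]
    refine ⟨?_, ?_, ?_⟩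
    · have hr : 0 ≤ 1 - (∑ j, p j) / m := sub_nonneg.2 ((div_le_one hm0).2 hpm)
      rintro (i | i) (j | j)
      · simp only [M, Matrix.fromBlocks_apply₁₁, Matrix.diagonal_apply]
        split_ifs <;> simp [hr]
      · simpa [M] using div_nonneg (hp0 j) hm0.le
      · simpa [M] using div_nonneg (hp0 i) hm0.le
      · simp only [M, Matrix.fromBlocks_apply₂₂, Matrix.diagonal_apply]
        split_ifs <;> simp [hp1]
    · rintro (i | i)
      · simp [M, Matrix.diagonal_apply, Finset.sum_div]
      · simp [M, Matrix.diagonal_apply]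
        field_simp
        ring
    · rintro (i | i)
      · simp [M, Matrix.diagonal_apply, Finset.sum_div]
      · simp [M, Matrix.diagonal_apply]
        field_simp
        ring
  obtain ⟨w, hw0, hw1, hw⟩ := exists_eq_sum_perm_of_mem_doublyStochastic hM
  refine ⟨w, hw0, hw1, fun i j => ?_⟩
  have h := congrFun₂ hw (Sum.inl i) (Sum.inr j)
  simpa [M, Matrix.sum_apply, PEquiv.toMatrix_apply] using h

lemma sum_conjTranspose_mul_self_eq_one {d m : ℕ} {ι : Type*} [Fintype ι]
    {K : ι → Matrix (Fin m) (Fin d) ℂ}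
    (hrow : ∀ l i j k, j ≠ k → K l i j * star (K l i k) = 0)
    (hcol : ∀ j, ∑ l, ∑ i, ‖K l i j‖ ^ 2 = 1) : ∑ l, (K l)ᴴ * K l = 1 := by
  ext j k
  simp only [Matrix.sum_apply, Matrix.mul_apply, Matrix.conjTranspose_apply]
  by_cases hjk : j = k
  · subst hjk
    simp only [Complex.star_def, Complex.conj_mul', Matrix.one_apply_eq]
    exact_mod_cast hcol j
  · rw [Matrix.one_apply_ne hjk]
    refine Finset.sum_eq_zero fun l _ => Finset.sum_eq_zero fun i _ => ?_
    rw [mul_comm]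
    exact hrow l i k j (Ne.symm hjk)

/-- Every dual feasible `z` yields a strictly incoherent Kraus family attaining at least the
corresponding dual value. -/
lemma exists_kraus_of_dual {d m : ℕ} (hm : 1 ≤ m) (ψ : Fin d → ℂ) (z : Fin d → ℝ)
    (hz0 : ∀ j, 0 ≤ z j) (hz1 : ∀ j, z j ≤ 1) (hzm : ∑ j, z j ^ 2 ≤ m) :
    ∃ K : Equiv.Perm (Fin m ⊕ Fin d) ⊕ Fin d → Matrix (Fin m) (Fin d) ℂ,
      (∀ l, IsIncoherentOp (K l) ∧ IsIncoherentOp (K l)ᴴ) ∧ ∑ l, (K l)ᴴ * K l = 1 ∧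
      (∑ j, z j * ‖ψ j‖) ^ 2 ≤ ∑ l, ‖∑ i, (K l *ᵥ ψ) i‖ ^ 2 := by
  classical
  have hm0 : (m : ℝ) ≠ 0 := by positivity
  obtain ⟨w, hw0, hw1, hw⟩ := exists_perm_weights hm (fun j => z j ^ 2) (fun j => sq_nonneg _)
    (fun j => pow_le_one₀ (hz0 j) (hz1 j)) hzm
  let u : Fin d → ℂ := fun j => Complex.exp (Complex.arg (ψ j) * Complex.I)
  have hu : ∀ j, ‖u j‖ = 1 := fun j => Complex.norm_exp_ofReal_mul_I _
  have huψ : ∀ j, star (u j) * ψ j = ‖ψ j‖ := by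
    intro j
    have h := Complex.norm_mul_exp_arg_mul_I (ψ j)
    calc star (u j) * ψ j = star (u j) * (‖ψ j‖ * u j) := by rw [h]
      _ = ‖ψ j‖ * (star (u j) * u j) := by ring
      _ = ‖ψ j‖ := by rw [Complex.star_def, Complex.conj_mul', hu]; simp
  let K : Equiv.Perm (Fin m ⊕ Fin d) ⊕ Fin d → Matrix (Fin m) (Fin d) ℂ :=
    Sum.elim
      (fun σ => Matrix.of fun i j =>
        if σ (Sum.inl i) = Sum.inr j then ((Real.sqrt (w σ) / z j : ℝ) : ℂ) * star (u j) else 0)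
      (fun k => Matrix.of fun i j => if i = ⟨0, hm⟩ ∧ j = k ∧ z j = 0 then 1 else 0)
  have hcol : ∀ l i k j, i ≠ k → K l i j * star (K l k j) = 0 := by
    rintro (σ | t) i k j hik
    · by_cases h₁ : σ (Sum.inl i) = Sum.inr j
      · by_cases h₂ : σ (Sum.inl k) = Sum.inr j
        · exact absurd (Sum.inl_injective (σ.injective (h₁.trans h₂.symm))) hik
        · simp [K, h₂]
      · simp [K, h₁]
    · by_cases h₁ : i = ⟨0, hm⟩
      · have h₂ : k ≠ ⟨0, hm⟩ := fun h => hik (h₁.trans h.symm)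
        simp [K, h₂]
      · simp [K, h₁]
  have hrow : ∀ l i j k, j ≠ k → K l i j * star (K l i k) = 0 := by
    rintro (σ | t) i j k hjk
    · by_cases h₁ : σ (Sum.inl i) = Sum.inr j
      · have h₂ : σ (Sum.inl i) ≠ Sum.inr k := fun h => hjk (Sum.inr_injective (h₁.symm.trans h))
        simp [K, h₂]
      · simp [K, h₁]
    · by_cases h₁ : j = t
      · have h₂ : k ≠ t := fun h => hjk (h₁.trans h.symm)
        simp [K, h₂]
      · simp [K, h₁]
  refine ⟨K, fun l => ⟨isIncoherentOp_of_mul_star_eq_zero (hcol l),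
    isIncoherentOp_of_mul_star_eq_zero fun j k i hjk => ?_⟩,
    sum_conjTranspose_mul_self_eq_one hrow fun j => ?_, ?_⟩
  · rw [Matrix.conjTranspose_apply, Matrix.conjTranspose_apply, star_star, mul_comm]
    exact hrow l i k j hjk.symm
  · rw [Fintype.sum_sum_type]
    have h₁ : ∑ σ, ∑ i, ‖K (Sum.inl σ) i j‖ ^ 2 = z j ^ 2 / z j ^ 2 := by
      have : ∀ σ i, ‖K (Sum.inl σ) i j‖ ^ 2 =
          w σ * (if σ (Sum.inl i) = Sum.inr j then 1 else 0) / z j ^ 2 := by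
        intro σ i
        by_cases h : σ (Sum.inl i) = Sum.inr j
        · simp only [K, Sum.elim_inl, Matrix.of_apply, h, if_true, norm_mul, norm_star, hu,
            mul_one, Complex.norm_real, Real.norm_eq_abs, sq_abs, div_pow, Real.sq_sqrt (hw0 σ)]
        · simp [K, h]
      simp only [this]
      rw [Finset.sum_comm]
      simp only [← Finset.sum_div, hw]
      simp [hm0]
    have h₂ : ∑ t, ∑ i, ‖K (Sum.inr t) i j‖ ^ 2 = if z j = 0 then 1 else 0 := by
      by_cases h : z j = 0
      · rw [if_pos h, Finset.sum_eq_single j, Finset.sum_eq_single ⟨0, hm⟩]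
        · simp [K, h]
        · intro i _ hi
          simp [K, hi]
        · simp
        · intro t _ ht
          simp [K, ht.symm]
        · simp
      · simp [K, h]
    rw [h₁, h₂]
    by_cases h : z j = 0 <;> simp [h]
  · let s : Equiv.Perm (Fin m ⊕ Fin d) → ℝ := fun σ =>
      ∑ i, ∑ j, (if σ (Sum.inl i) = Sum.inr j then 1 else 0) * (‖ψ j‖ / z j)
    have hs : ∀ σ, ‖∑ i, (K (Sum.inl σ) *ᵥ ψ) i‖ ^ 2 = (Real.sqrt (w σ) * s σ) ^ 2 := by
      intro σ
      have : ∑ i, (K (Sum.inl σ) *ᵥ ψ) i = ((Real.sqrt (w σ) * s σ : ℝ) : ℂ) := by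
        simp only [s, Finset.mul_sum, Complex.ofReal_sum, Matrix.mulVec, dotProduct]
        refine Finset.sum_congr rfl fun i _ => Finset.sum_congr rfl fun j _ => ?_
        by_cases h : σ (Sum.inl i) = Sum.inr j
        · simp only [K, Sum.elim_inl, Matrix.of_apply, h, if_true]
          rw [mul_assoc, huψ]
          push_cast
          ring
        · simp [K, h]
      rw [this, Complex.norm_real, Real.norm_eq_abs, sq_abs]
    have hws : ∑ σ, Real.sqrt (w σ) * (Real.sqrt (w σ) * s σ) = ∑ j, z j * ‖ψ j‖ := by
      calc _ = ∑ i : Fin m, ∑ j,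
            (∑ σ, w σ * (if σ (Sum.inl i) = Sum.inr j then 1 else 0)) * (‖ψ j‖ / z j) := by
            simp only [← mul_assoc, Real.mul_self_sqrt (hw0 _), s, Finset.mul_sum, Finset.sum_mul]
            rw [Finset.sum_comm]
            refine Finset.sum_congr rfl fun i _ => ?_
            rw [Finset.sum_comm]
        _ = _ := by
            simp only [hw]
            rw [Finset.sum_const, Finset.card_univ, Fintype.card_fin, nsmul_eq_mul,
              Finset.mul_sum]
            refine Finset.sum_congr rfl fun j _ => ?_
            by_cases h : z j = 0
            · simp [h]
            · field_simp
    have hcs := Finset.sum_mul_sq_le_sq_mul_sq Finset.univ (fun σ => Real.sqrt (w σ))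
      (fun σ => Real.sqrt (w σ) * s σ)
    simp only [hws, Real.sq_sqrt (hw0 _), hw1, one_mul] at hcs
    rw [Fintype.sum_sum_type]
    simp only [hs]
    exact hcs.trans (le_add_of_nonneg_right (Finset.sum_nonneg fun _ _ => sq_nonneg _))

lemma mnorm_nonneg {d : ℕ} (m : ℝ) (ψ : Fin d → ℂ) : 0 ≤ mnorm m ψ := by
  refine Real.sInf_nonneg ?_
  rintro _ ⟨x, y, -, rfl⟩
  positivity

/-- The `m`-distillation norm of a unit vector is dominated by some dual feasible value. -/
lemma exists_dual_mnorm_le {d : ℕ} (ψ : Fin d → ℂ) (hψ : ∑ i, ‖ψ i‖ ^ 2 = 1) (m : ℕ)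
    (hm : 1 ≤ m) : ∃ z : Fin d → ℝ, (∀ j, 0 ≤ z j) ∧ (∀ j, z j ≤ 1) ∧ ∑ j, z j ^ 2 ≤ m ∧
      mnorm m ψ ≤ ∑ j, z j * ‖ψ j‖ := by
  obtain ⟨z, x, y, hz0, hz1, hzm, hx, hy, hxy, h⟩ :=
    exists_split_and_dual (fun j => ‖ψ j‖) (fun j => norm_nonneg _) hψ m hm
  refine ⟨z, hz0, hz1, hzm, ?_⟩
  rw [← h]
  refine csInf_le ⟨0, ?_⟩ ⟨fun j => x j * Complex.exp (Complex.arg (ψ j) * Complex.I),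
    fun j => y j * Complex.exp (Complex.arg (ψ j) * Complex.I), ?_, ?_⟩
  · rintro _ ⟨x, y, -, rfl⟩
    positivity
  · funext j
    rw [Pi.add_apply, ← add_mul, ← Complex.ofReal_add, hxy j, Complex.norm_mul_exp_arg_mul_I]
  · simp only [norm_mul, Complex.norm_exp_ofReal_mul_I, mul_one, Complex.norm_real,
      Real.norm_eq_abs, abs_of_nonneg (hx _), abs_of_nonneg (hy _)]

/-- for pure states the SIO distillation fidelity equals the normalized
squared m-distillation norm: F_SIO(ψψ*, m) = (1/m)·‖ψ‖_[m]². -/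
theorem fidelity_SIO_pure {d : ℕ} (ψ : Fin d → ℂ) (hψ : ∑ i, ‖ψ i‖ ^ 2 = 1)
    (m : ℕ) (hm : 1 ≤ m) :
    FSIO (outer ψ) m = (1 / (m : ℝ)) * (mnorm (m : ℝ) ψ) ^ 2 := by
  have hub : ∀ r ∈ {x : ℝ | ∃ (n : ℕ) (K : Fin n → Matrix (Fin m) (Fin d) ℂ),
      (∀ ℓ, IsIncoherentOp (K ℓ) ∧ IsIncoherentOp (K ℓ)ᴴ) ∧ (∑ ℓ, (K ℓ)ᴴ * K ℓ = 1) ∧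
      x = (((∑ ℓ, K ℓ * outer ψ * (K ℓ)ᴴ) * maxCoh m).trace).re},
      r ≤ (1 / (m : ℝ)) * (mnorm (m : ℝ) ψ) ^ 2 := by
    rintro _ ⟨n, K, hK, h1, rfl⟩
    rw [re_trace_kraus_outer_mul_maxCoh]
    refine mul_le_mul_of_nonneg_left ?_ (by positivity)
    refine (Real.sqrt_le_left (mnorm_nonneg _ _)).1 ?_
    refine le_csInf ⟨_, ψ, 0, add_zero ψ, rfl⟩ ?_
    rintro _ ⟨x, y, rfl, rfl⟩
    exact sqrt_sum_norm_sq_le (fun l => (hK l).1) h1 x y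
  obtain ⟨z, hz0, hz1, hzm, hz⟩ := exists_dual_mnorm_le ψ hψ m hm
  obtain ⟨K, hK, h1, hval⟩ := exists_kraus_of_dual hm ψ z hz0 hz1 hzm
  let e := (Fintype.equivFin (Equiv.Perm (Fin m ⊕ Fin d) ⊕ Fin d)).symm
  refine (IsLUB.csSup_eq ⟨hub, fun b hb => ?_⟩ ⟨_, _, K ∘ e, fun l => hK (e l), ?_, rfl⟩)
  · refine le_trans ?_ (hb ⟨_, K ∘ e, fun l => hK (e l), ?_, rfl⟩)
    · rw [re_trace_kraus_outer_mul_maxCoh]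
      refine mul_le_mul_of_nonneg_left ?_ (by positivity)
      refine (pow_le_pow_left₀ (mnorm_nonneg _ _) hz 2).trans (hval.trans (le_of_eq ?_))
      exact (e.sum_comp fun l => ‖∑ i, (K l *ᵥ ψ) i‖ ^ 2).symm
    · exact (e.sum_comp fun l => (K l)ᴴ * K l).trans h1
  · exact (e.sum_comp fun l => (K l)ᴴ * K l).trans h1
end

section
/- Zero-error one-shot distillable coherence of pure states: for every unit vector ψ ∈ ℂ^d, the largest positive integer m for which there exists a Hermitian d×d matrix G with 0 ≤ G ≤ 𝟙, Δ(G) = (1/m)𝟙, and Re⟨ψ, Gψ⟩ = 1, equals ⌊ 1 / ‖ψ‖_∞² ⌋, where ‖ψ‖_∞ = max_i |ψ_i|. (The left-hand side is the zero-error distillable coherence 2^{C^{(1),0}_{d,MIO}(ψψ*)} by the SDP characterization of the fidelity of distillation under MIO.) -/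
open Matrix Kronecker BigOperators ComplexOrder

/-- The hypersimplex: a vector in `[0, 1]^d` with integral sum `m` is the vector of inclusion
probabilities of a random `m`-element subset. -/
lemma exists_weights_finset_card_eq {d m : ℕ} (hm : 0 < m) (r : Fin d → ℝ)
    (h0 : ∀ i, 0 ≤ r i) (h1 : ∀ i, r i ≤ 1) (hr : ∑ i, r i = m) :
    ∃ (w : Equiv.Perm (Fin d) → ℝ) (T : Equiv.Perm (Fin d) → Finset (Fin d)),
      (∀ σ, 0 ≤ w σ) ∧ ∑ σ, w σ = 1 ∧ (∀ σ, (T σ).card = m) ∧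
      ∀ i, ∑ σ, w σ * (if i ∈ T σ then 1 else 0) = r i := by
  have hmd : m ≤ d := by
    have : ∑ i, r i ≤ ∑ _i : Fin d, (1 : ℝ) := Finset.sum_le_sum fun i _ => h1 i
    rw [hr] at this
    simpa using this
  have hm' : (m : ℝ) ≠ 0 := by positivity
  have hcard : (Finset.univ.filter fun j : Fin d => (j : ℕ) < m).card = m := by
    rw [Fin.card_filter_val_lt, min_eq_right hmd]
  have hcard' : (Finset.univ.filter fun j : Fin d => ¬ (j : ℕ) < m).card = d - m := by
    have := Finset.card_filter_add_card_filter_not (s := (Finset.univ : Finset (Fin d)))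
      (fun j : Fin d => (j : ℕ) < m)
    rw [hcard, Finset.card_univ, Fintype.card_fin] at this
    omega
  let B : Matrix (Fin d) (Fin d) ℝ :=
    Matrix.of fun i j => if (j : ℕ) < m then r i / m else (1 - r i) / ((d : ℝ) - m)
  have hB : B ∈ doublyStochastic ℝ (Fin d) := by
    rw [mem_doublyStochastic_iff_sum]
    refine ⟨fun i j => ?_, fun i => ?_, fun j => ?_⟩
    · have hdm : (0 : ℝ) ≤ (d : ℝ) - m := sub_nonneg.2 (by exact_mod_cast hmd)
      simp only [B, Matrix.of_apply]
      split_ifs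
      · exact div_nonneg (h0 i) (by positivity)
      · exact div_nonneg (sub_nonneg.2 (h1 i)) hdm
    · simp only [B, Matrix.of_apply]
      rw [Finset.sum_ite, Finset.sum_const, Finset.sum_const, hcard, hcard', nsmul_eq_mul,
        nsmul_eq_mul, Nat.cast_sub hmd]
      rcases eq_or_lt_of_le hmd with rfl | hlt
      · have hi : 1 - r i = 0 := by
          refine (Finset.sum_eq_zero_iff_of_nonneg (s := Finset.univ)
            (f := fun i => 1 - r i) fun i _ => sub_nonneg.2 (h1 i)).1 ?_ i (Finset.mem_univ i)
          simp [hr]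
        rw [hi]
        field_simp
        linarith
      · have : (d : ℝ) - m ≠ 0 := sub_ne_zero.2 (by exact_mod_cast hlt.ne')
        field_simp
        ring
    · simp only [B, Matrix.of_apply]
      split_ifs with h
      · rw [← Finset.sum_div, hr, div_self hm']
      · have hlt : m < d := lt_of_le_of_lt (not_lt.1 h) j.2
        have : (d : ℝ) - m ≠ 0 := sub_ne_zero.2 (by exact_mod_cast hlt.ne')
        rw [← Finset.sum_div, Finset.sum_sub_distrib, hr]
        simp [div_self this]
  obtain ⟨w, hw0, hw1, hw⟩ := exists_eq_sum_perm_of_mem_doublyStochastic hB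
  refine ⟨w, fun σ => Finset.univ.filter fun i => (σ i : ℕ) < m, hw0, hw1, fun σ => ?_,
    fun i => ?_⟩
  · refine Eq.trans ?_ hcard
    exact Finset.card_bij (fun i _ => σ i) (by simp) (fun a _ b _ h => σ.injective h)
      fun b hb => ⟨σ.symm b, by simpa using hb, by simp⟩
  · have hri : r i = ∑ j ∈ Finset.univ.filter (fun j : Fin d => (j : ℕ) < m), B i j := by
      rw [Finset.sum_congr rfl (g := fun _ => r i / m)]
      · rw [Finset.sum_const, hcard, nsmul_eq_mul]
        field_simp
      · intro j hj
        simp only [Finset.mem_filter, Finset.mem_univ, true_and] at hj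
        simp [B, hj]
    rw [hri, ← hw]
    simp only [Matrix.sum_apply, Matrix.smul_apply, smul_eq_mul]
    rw [Finset.sum_comm]
    refine Finset.sum_congr rfl fun σ _ => ?_
    rw [← Finset.mul_sum]
    congr 1
    simp [PEquiv.toMatrix_apply]

lemma trace_outer_mul {d : ℕ} (ψ : Fin d → ℂ) (G : Matrix (Fin d) (Fin d) ℂ) :
    (outer ψ * G).trace = star ψ ⬝ᵥ (G *ᵥ ψ) := by
  simp only [Matrix.trace, Matrix.diag_apply, Matrix.mul_apply, outer, Matrix.of_apply,
    dotProduct, Matrix.mulVec, Pi.star_apply, Finset.mul_sum]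
  rw [Finset.sum_comm]
  exact Finset.sum_congr rfl fun i _ => Finset.sum_congr rfl fun j _ => by ring

lemma star_dotProduct_self {d : ℕ} (x : Fin d → ℂ) :
    star x ⬝ᵥ x = ((∑ i, ‖x i‖ ^ 2 : ℝ) : ℂ) := by
  simp [dotProduct, Complex.conj_mul']

/-- If `0 ≤ G ≤ 1` and `⟨ψ, G ψ⟩ = 1` for a unit vector `ψ`, then `ψψ* ≤ G` on the diagonal. -/
lemma norm_sq_le_diag {d : ℕ} (ψ : Fin d → ℂ) (hψ : ∑ i, ‖ψ i‖ ^ 2 = 1)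
    (G : Matrix (Fin d) (Fin d) ℂ) (hG : G.PosSemidef) (hG' : (1 - G).PosSemidef)
    (h : (star ψ ⬝ᵥ (G *ᵥ ψ)).re = 1) (i : Fin d) : ‖ψ i‖ ^ 2 ≤ (G i i).re := by
  have hone : star ψ ⬝ᵥ ψ = 1 := by rw [star_dotProduct_self, hψ, Complex.ofReal_one]
  have hfix : G *ᵥ ψ = ψ := by
    have hz : star ψ ⬝ᵥ ((1 - G) *ᵥ ψ) = 0 := by
      have h0 := hG.dotProduct_mulVec_nonneg ψ
      rw [Matrix.sub_mulVec, Matrix.one_mulVec, dotProduct_sub, hone]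
      apply Complex.ext
      · simp [h]
      · simp [← (Complex.le_def.1 h0).2]
    rw [hG'.dotProduct_mulVec_zero_iff, Matrix.sub_mulVec, Matrix.one_mulVec, sub_eq_zero] at hz
    exact hz.symm
  have hfix' : star ψ ᵥ* G = star ψ := by
    rw [← hG.1.eq, ← Matrix.star_mulVec, hfix]
  have key := hG.dotProduct_mulVec_nonneg (Pi.single i 1 - star (ψ i) • ψ)
  have hval : star (Pi.single i 1 - star (ψ i) • ψ) ⬝ᵥ (G *ᵥ (Pi.single i 1 - star (ψ i) • ψ))
      = G i i - ((‖ψ i‖ ^ 2 : ℝ) : ℂ) := by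
    have hs : star (Pi.single i 1 : Fin d → ℂ) = Pi.single i 1 := by
      rw [← Pi.single_star, star_one]
    have hc : ψ i * star (ψ i) = ((‖ψ i‖ ^ 2 : ℝ) : ℂ) := by
      simpa using Complex.mul_conj' (ψ i)
    rw [Matrix.mulVec_sub, Matrix.mulVec_smul, hfix, star_sub, star_smul, star_star, hs,
      sub_dotProduct, dotProduct_sub, dotProduct_sub, smul_dotProduct, smul_dotProduct,
      dotProduct_smul, dotProduct_smul, hone, dotProduct_mulVec (star ψ), hfix', ← hc]
    simp [smul_eq_mul]
    ring
  rw [hval] at key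
  have := (Complex.le_def.1 key).1
  rw [Complex.sub_re, Complex.ofReal_re, Complex.zero_re] at this
  linarith

lemma star_dotProduct_vecMulVec_mulVec {d : ℕ} (v x : Fin d → ℂ) :
    star x ⬝ᵥ (vecMulVec v (star v) *ᵥ x) = ((‖star v ⬝ᵥ x‖ ^ 2 : ℝ) : ℂ) := by
  rw [Matrix.vecMulVec_mulVec, dotProduct_smul, Complex.ofReal_pow, ← Complex.mul_conj']
  have : star x ⬝ᵥ v = (starRingEnd ℂ) (star v ⬝ᵥ x) := by
    rw [starRingEnd_apply, ← star_dotProduct_star, star_star]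
  rw [this]
  simp [mul_comm]

/-- The entrywise reciprocal of `star ψ`, restricted to `T` and scaled by `m⁻¹`. -/
noncomputable def recipOn {d : ℕ} (m : ℕ) (ψ : Fin d → ℂ) (T : Finset (Fin d)) : Fin d → ℂ :=
  fun i => if i ∈ T then ((m : ℂ) * star (ψ i))⁻¹ else 0

lemma star_recipOn_dotProduct {d : ℕ} (m : ℕ) (ψ x : Fin d → ℂ) (T : Finset (Fin d)) :
    star (recipOn m ψ T) ⬝ᵥ x = ∑ i ∈ T, ((m : ℂ) * ψ i)⁻¹ * x i := by
  simp [dotProduct, recipOn, apply_ite, ite_mul, Finset.sum_ite_mem]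

lemma norm_sq_star_recipOn_dotProduct_le {d m : ℕ} (hm : 0 < m) (ψ x : Fin d → ℂ)
    (T : Finset (Fin d)) (hT : T.card = m) :
    ‖star (recipOn m ψ T) ⬝ᵥ x‖ ^ 2 ≤
      ∑ i, (if i ∈ T then 1 else 0) * (‖x i‖ ^ 2 / (m * ‖ψ i‖ ^ 2)) := by
  rw [star_recipOn_dotProduct]
  calc ‖∑ i ∈ T, ((m : ℂ) * ψ i)⁻¹ * x i‖ ^ 2
      ≤ (∑ i ∈ T, ‖((m : ℂ) * ψ i)⁻¹ * x i‖) ^ 2 := by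
        gcongr
        exact norm_sum_le _ _
    _ ≤ T.card * ∑ i ∈ T, ‖((m : ℂ) * ψ i)⁻¹ * x i‖ ^ 2 := sq_sum_le_card_mul_sum_sq
    _ = _ := by
        simp only [ite_mul, one_mul, zero_mul, Finset.sum_ite_mem, Finset.univ_inter, hT,
          Finset.mul_sum]
        refine Finset.sum_congr rfl fun i _ => ?_
        have : (m : ℝ) ≠ 0 := by positivity
        simp only [norm_mul, norm_inv, Complex.norm_natCast, mul_pow, inv_pow, mul_inv]
        field_simp

/-- If every `|ψ i|²` is at most `1 / m`, then a feasible `G` with diagonal `1 / m` exists. -/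
lemma exists_distillation_witness {d m : ℕ} (hm : 0 < m) (ψ : Fin d → ℂ)
    (hψ : ∑ i, ‖ψ i‖ ^ 2 = 1) (hmψ : ∀ i, m * ‖ψ i‖ ^ 2 ≤ 1) :
    ∃ G : Matrix (Fin d) (Fin d) ℂ, G.PosSemidef ∧ (1 - G).PosSemidef ∧
      (∀ i, G i i = (m : ℂ)⁻¹) ∧ star ψ ⬝ᵥ (G *ᵥ ψ) = 1 := by
  have hm' : (m : ℝ) ≠ 0 := by positivity
  have hmC : (m : ℂ) ≠ 0 := by exact_mod_cast hm.ne'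
  obtain ⟨w, T, hw0, hw1, hT, hw⟩ := exists_weights_finset_card_eq hm
    (fun i => m * ‖ψ i‖ ^ 2) (fun i => by positivity) hmψ (by rw [← Finset.mul_sum, hψ, mul_one])
  have hsupp : ∀ σ, w σ ≠ 0 → ∀ i ∈ T σ, ψ i ≠ 0 := by
    intro σ hσ i hi h
    have hz := hw i
    simp only [h, norm_zero, ne_eq, OfNat.ofNat_ne_zero, not_false_eq_true, zero_pow,
      mul_zero] at hz
    rw [Finset.sum_eq_zero_iff_of_nonneg fun σ _ =>
      mul_nonneg (hw0 σ) (by split_ifs <;> norm_num)] at hz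
    exact hσ (by simpa [hi] using hz σ (Finset.mem_univ σ))
  let e : Fin d → ℝ := fun i => if ψ i = 0 then (m : ℝ)⁻¹ else 0
  have he0 : ∀ i, 0 ≤ e i := fun i => by simp only [e]; split_ifs <;> positivity
  let G : Matrix (Fin d) (Fin d) ℂ :=
    ∑ σ, (w σ : ℂ) • vecMulVec (recipOn m ψ (T σ)) (star (recipOn m ψ (T σ))) +
      Matrix.diagonal fun i => (e i : ℂ)
  have hquad : ∀ x, star x ⬝ᵥ (G *ᵥ x) =
      ((∑ σ, w σ * ‖star (recipOn m ψ (T σ)) ⬝ᵥ x‖ ^ 2 + ∑ i, e i * ‖x i‖ ^ 2 : ℝ) : ℂ) := by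
    intro x
    simp only [G, Matrix.add_mulVec, Matrix.sum_mulVec, Matrix.smul_mulVec, dotProduct_add,
      dotProduct_sum, dotProduct_smul, star_dotProduct_vecMulVec_mulVec]
    rw [Complex.ofReal_add, Complex.ofReal_sum, Complex.ofReal_sum]
    congr 1
    · exact Finset.sum_congr rfl fun σ _ => by simp
    · simp only [dotProduct, Matrix.mulVec_diagonal, Pi.star_apply]
      refine Finset.sum_congr rfl fun i _ => ?_
      rw [Complex.ofReal_mul, Complex.ofReal_pow, ← Complex.conj_mul']
      simp only [starRingEnd_apply]
      ring
  have hG : G.PosSemidef := by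
    refine .add (Matrix.posSemidef_sum _ fun σ _ => ?_) (.diagonal fun i => ?_)
    · exact (posSemidef_vecMulVec_self_star _).smul (by exact_mod_cast hw0 σ)
    · exact Complex.zero_le_real.2 (he0 i)
  refine ⟨G, hG, .of_dotProduct_mulVec_nonneg (Matrix.isHermitian_one.sub hG.1) fun x => ?_,
    fun i => ?_, ?_⟩
  · rw [Matrix.sub_mulVec, Matrix.one_mulVec, dotProduct_sub, hquad, star_dotProduct_self,
      ← Complex.ofReal_sub, Complex.zero_le_real, sub_nonneg]
    calc ∑ σ, w σ * ‖star (recipOn m ψ (T σ)) ⬝ᵥ x‖ ^ 2 + ∑ i, e i * ‖x i‖ ^ 2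
        ≤ ∑ σ, w σ * ∑ i, (if i ∈ T σ then 1 else 0) * (‖x i‖ ^ 2 / (m * ‖ψ i‖ ^ 2)) +
            ∑ i, e i * ‖x i‖ ^ 2 := by
          gcongr with σ _
          · exact hw0 σ
          · exact norm_sq_star_recipOn_dotProduct_le hm ψ x _ (hT σ)
      _ = ∑ i, ((m * ‖ψ i‖ ^ 2) * (‖x i‖ ^ 2 / (m * ‖ψ i‖ ^ 2)) + e i * ‖x i‖ ^ 2) := by
          rw [Finset.sum_add_distrib]
          congr 1
          simp_rw [Finset.mul_sum]
          rw [Finset.sum_comm]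
          refine Finset.sum_congr rfl fun i _ => ?_
          rw [← hw i, Finset.sum_mul]
          exact Finset.sum_congr rfl fun σ _ => by rw [hw i]; ring
      _ ≤ ∑ i, ‖x i‖ ^ 2 := by
          refine Finset.sum_le_sum fun i _ => ?_
          by_cases h : ψ i = 0
          · simp only [e, h, if_true, norm_zero]
            have : (m : ℝ)⁻¹ ≤ 1 := inv_le_one_of_one_le₀ (by exact_mod_cast hm)
            nlinarith [sq_nonneg ‖x i‖]
          · have : ‖ψ i‖ ≠ 0 := norm_ne_zero_iff.2 h
            simp only [e, h, if_false]
            field_simp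
            simp
  · have hterm : ∀ σ, (w σ : ℂ) * (recipOn m ψ (T σ) i * star (recipOn m ψ (T σ) i)) =
        ((w σ * (if i ∈ T σ then 1 else 0) * ((m * ‖ψ i‖) ^ 2)⁻¹ : ℝ) : ℂ) := by
      intro σ
      have hc : recipOn m ψ (T σ) i * star (recipOn m ψ (T σ) i) =
          ((‖recipOn m ψ (T σ) i‖ ^ 2 : ℝ) : ℂ) := by
        simpa using Complex.mul_conj' (recipOn m ψ (T σ) i)
      rw [hc, ← Complex.ofReal_mul]
      congr 1
      simp only [recipOn]
      split_ifs <;> simp [mul_pow, mul_comm]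
    have hval : G i i = ((∑ σ, w σ * (if i ∈ T σ then 1 else 0) * ((m * ‖ψ i‖) ^ 2)⁻¹ + e i : ℝ)
        : ℂ) := by
      simp only [G, Matrix.add_apply, Matrix.sum_apply, Matrix.smul_apply, vecMulVec_apply,
        Pi.star_apply, smul_eq_mul, hterm, Matrix.diagonal_apply_eq, Complex.ofReal_add,
        Complex.ofReal_sum]
    rw [hval, ← Finset.sum_mul, hw i, ← Complex.ofReal_natCast, ← Complex.ofReal_inv]
    congr 1
    by_cases h : ψ i = 0
    · simp [e, h]
    · have : ‖ψ i‖ ≠ 0 := norm_ne_zero_iff.2 h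
      simp only [e, h, if_false]
      field_simp
      simp
  · rw [hquad, Complex.ofReal_eq_one]
    have h1 : ∀ σ, w σ * ‖star (recipOn m ψ (T σ)) ⬝ᵥ ψ‖ ^ 2 = w σ := by
      intro σ
      by_cases hσ : w σ = 0
      · simp [hσ]
      · have : star (recipOn m ψ (T σ)) ⬝ᵥ ψ = 1 := by
          rw [star_recipOn_dotProduct, Finset.sum_congr rfl (g := fun _ => (m : ℂ)⁻¹)]
          · rw [Finset.sum_const, hT σ, nsmul_eq_mul, mul_inv_cancel₀ hmC]
          · intro i hi
            have := hsupp σ hσ i hi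
            field_simp
        simp [this]
    have h2 : ∀ i, e i * ‖ψ i‖ ^ 2 = 0 := fun i => by
      by_cases h : ψ i = 0 <;> simp [e, h]
    simp [h1, h2, hw1]

/-- zero-error one-shot distillable coherence of pure states: for a unit
vector ψ ∈ ℂ^d, the largest positive integer m admitting a Hermitian G with 0 ≤ G ≤ 𝟙,
Δ(G) = (1/m)𝟙 and Re Tr(ψψ* G) = 1 is ⌊1/‖ψ‖_∞²⌋, where ‖ψ‖_∞ = max_i |ψ_i|. -/
theorem zero_error_distillable_coherence {d : ℕ} (hd : 1 ≤ d)
    (ψ : Fin d → ℂ) (hψ : ∑ i, ‖ψ i‖ ^ 2 = 1) :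
    IsGreatest
      {m : ℕ | 0 < m ∧ ∃ G : Matrix (Fin d) (Fin d) ℂ, G.IsHermitian ∧
        G.PosSemidef ∧ (1 - G).PosSemidef ∧
        deph G = ((m : ℂ))⁻¹ • (1 : Matrix (Fin d) (Fin d) ℂ) ∧
        ((outer ψ * G).trace).re = 1}
      ⌊1 / (⨆ i, ‖ψ i‖) ^ 2⌋₊ := by
  have : Nonempty (Fin d) := ⟨⟨0, hd⟩⟩
  obtain ⟨k, hk⟩ := exists_eq_ciSup_of_finite (f := fun i => ‖ψ i‖)
  have hle : ∀ i, ‖ψ i‖ ≤ ‖ψ k‖ := fun i =>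
    (le_ciSup (Set.finite_range fun i => ‖ψ i‖).bddAbove i).trans_eq hk.symm
  rw [← hk]
  have hpos : 0 < ‖ψ k‖ := by
    refine lt_of_le_of_ne (norm_nonneg _) fun h => ?_
    have hz : ∀ i, ‖ψ i‖ = 0 := fun i => le_antisymm ((hle i).trans_eq h.symm) (norm_nonneg _)
    simp [hz] at hψ
  have hle1 : ‖ψ k‖ ^ 2 ≤ 1 :=
    (Finset.single_le_sum (f := fun i => ‖ψ i‖ ^ 2) (fun i _ => by positivity)
      (Finset.mem_univ k)).trans_eq hψ
  constructor
  · have hm : 0 < ⌊1 / ‖ψ k‖ ^ 2⌋₊ :=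
      Nat.floor_pos.2 ((one_le_div (by positivity)).2 hle1)
    have hfloor : (⌊1 / ‖ψ k‖ ^ 2⌋₊ : ℝ) * ‖ψ k‖ ^ 2 ≤ 1 :=
      (le_div_iff₀ (by positivity)).1 (Nat.floor_le (by positivity))
    obtain ⟨G, hG, hG', hdiag, hone⟩ := exists_distillation_witness hm ψ hψ fun i =>
      le_trans (by gcongr; exact hle i) hfloor
    refine ⟨hm, G, hG.1, hG, hG', ?_, by rw [trace_outer_mul, hone, Complex.one_re]⟩
    simp [deph, hdiag, Matrix.smul_one_eq_diagonal]
  · rintro m ⟨hm, G, -, hG, hG', hdiag, htr⟩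
    rw [trace_outer_mul] at htr
    have hGk : G k k = ((m : ℝ)⁻¹ : ℝ) := by
      simpa [deph] using congrFun (congrFun hdiag k) k
    have hb := norm_sq_le_diag ψ hψ G hG hG' htr k
    rw [hGk, Complex.ofReal_re] at hb
    refine Nat.le_floor ?_
    rw [le_div_iff₀ (by positivity), mul_comm]
    exact (le_inv_mul_iff₀' (by positivity)).1 (by simpa using hb)
end
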